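/- For any 2×2 real symmetric matrix N and any 2×2 real matrix T, the Hermitian matrix C(T,N) is positive semidefinite if and only if trace N ≥ 0 and det N ≥ (1 − det T)². -/

import Mathlib

open Matrix Complex
open scoped ComplexOrder

/-- The one-mode symplectic form `Ω = !![0, 1; -1, 0]`. -/
noncomputable def Omega : Matrix (Fin 2) (Fin 2) ℝ := !![0, 1; -1, 0]

/-- The complete-positivity matrix `C(T,N) = N + i·Ω − i·T·Ω·Tᵀ`, real matrices viewed as
complex via the canonical embedding. -/
noncomputable def Cmat (T N : Matrix (Fin 2) (Fin 2) ℝ) : Matrix (Fin 2) (Fin 2) ℂ :=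
  N.map (fun x => (x : ℂ)) + Complex.I • (Omega.map (fun x => (x : ℂ)))
    - Complex.I • ((T * Omega * Tᵀ).map (fun x => (x : ℂ)))

/-- A Hermitian `2 × 2` matrix is positive semidefinite iff its trace and determinant are
nonnegative. -/
theorem Matrix.IsHermitian.posSemidef_fin_two_iff {A : Matrix (Fin 2) (Fin 2) ℂ}
    (hA : A.IsHermitian) : A.PosSemidef ↔ 0 ≤ A.trace ∧ 0 ≤ A.det := by
  refine ⟨fun h => ⟨h.trace_nonneg, h.det_nonneg⟩, fun ⟨htr, hdet⟩ => ?_⟩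
  rw [hA.trace_eq_sum_eigenvalues, Fin.sum_univ_two, ← RCLike.ofReal_add,
    RCLike.ofReal_nonneg] at htr
  rw [hA.det_eq_prod_eigenvalues, Fin.prod_univ_two, ← RCLike.ofReal_mul,
    RCLike.ofReal_nonneg] at hdet
  rw [hA.posSemidef_iff_eigenvalues_nonneg, Pi.le_def, Fin.forall_fin_two]
  constructor <;> simp only [Pi.zero_apply] <;> by_contra! hneg <;> nlinarith

theorem mul_Omega_mul_transpose (T : Matrix (Fin 2) (Fin 2) ℝ) :
    T * Omega * Tᵀ = T.det • Omega := by
  ext i j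
  fin_cases i <;> fin_cases j <;>
    simp [Omega, Matrix.mul_apply, Matrix.det_fin_two] <;> ring

theorem Cmat_eq (T N : Matrix (Fin 2) (Fin 2) ℝ) :
    Cmat T N = !![(N 0 0 : ℂ), N 0 1 + I * (1 - T.det : ℝ);
      N 1 0 - I * (1 - T.det : ℝ), N 1 1] := by
  rw [Cmat, mul_Omega_mul_transpose]
  ext i j
  fin_cases i <;> fin_cases j <;> simp [Omega] <;> ring

theorem isHermitian_Cmat (T : Matrix (Fin 2) (Fin 2) ℝ) {N : Matrix (Fin 2) (Fin 2) ℝ}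
    (hN : N.IsSymm) : (Cmat T N).IsHermitian := by
  rw [Cmat_eq]
  ext i j
  fin_cases i <;> fin_cases j <;> simp [hN.apply 0 1, sub_eq_add_neg]

theorem trace_Cmat (T N : Matrix (Fin 2) (Fin 2) ℝ) : (Cmat T N).trace = (N.trace : ℝ) := by
  simp [Cmat_eq, Matrix.trace_fin_two]

theorem det_Cmat (T : Matrix (Fin 2) (Fin 2) ℝ) {N : Matrix (Fin 2) (Fin 2) ℝ}
    (hN : N.IsSymm) : (Cmat T N).det = (N.det - (1 - T.det) ^ 2 : ℝ) := by
  rw [Cmat_eq, Matrix.det_fin_two_of, Matrix.det_fin_two N, hN.apply 0 1]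
  push_cast
  linear_combination (1 - (T.det : ℂ)) ^ 2 * I_sq

/-- `C(T,N)` is positive semidefinite iff `trace N ≥ 0` and `det N ≥ (1 − det T)²`. -/
theorem stmt_2 (T N : Matrix (Fin 2) (Fin 2) ℝ) (hN : N.IsSymm) :
    (Cmat T N).PosSemidef ↔ 0 ≤ N.trace ∧ (1 - T.det) ^ 2 ≤ N.det := by
  rw [(isHermitian_Cmat T hN).posSemidef_fin_two_iff, trace_Cmat, det_Cmat T hN,
    zero_le_real, zero_le_real, sub_nonneg]
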